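/- arXiv:1812.11329 — 3 statements merged into one kernel-verified Lean document; each statement's English description precedes it below -/
import Mathlib

section
/- Let A ∈ ℝ^{m×n}, b ∈ ℝ^m, μ > 0, λ ≥ 0, and set z' = (I − AᵀA)x' + Aᵀb for x' ∈ ℝ^n. Then the following are equivalent: (i) 2z' ∈ ∂g_λ(x'), i.e. x' is a stationary point of r_{μ,λ}(x) + ‖Ax − b‖²; (ii) x' ∈ argmin_x r_{μ,λ}(x) + ‖x − z'‖². -/
noncomputable section

open scoped BigOperators

open Matrix

/-- ℓ¹ norm -/
def l1 {ι : Type*} [Fintype ι] (x : ι → ℝ) : ℝ := ∑ i, |x i|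

/-- squared Euclidean norm -/
def sqnorm {ι : Type*} [Fintype ι] (x : ι → ℝ) : ℝ := ∑ i, (x i) ^ 2

/-- Euclidean inner product -/
def ip {ι : Type*} [Fintype ι] (x y : ι → ℝ) : ℝ := ∑ i, x i * y i

/-- the regularizer `r_{μ,λ}(x) = Σᵢ (μ − max(√μ − |xᵢ|, 0)²) + λ‖x‖₁` -/
def reg {n : ℕ} (μ lam : ℝ) (x : Fin n → ℝ) : ℝ :=
  (∑ i, (μ - max (Real.sqrt μ - |x i|) 0 ^ 2)) + lam * l1 x

/-- `g_λ = r_{μ,λ} + ‖·‖²` -/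
def gfun {n : ℕ} (μ lam : ℝ) (x : Fin n → ℝ) : ℝ := reg μ lam x + sqnorm x

/-- subdifferential of a convex function on ℝⁿ -/
def subdiff {n : ℕ} (g : (Fin n → ℝ) → ℝ) (x : Fin n → ℝ) : Set (Fin n → ℝ) :=
  {s | ∀ y, g x + ip s (y - x) ≤ g y}

theorem sqnorm_sub {ι : Type*} [Fintype ι] (x z : ι → ℝ) :
    sqnorm (x - z) = sqnorm x - ip ((2 : ℝ) • z) x + sqnorm z := by
  simp only [sqnorm, ip, ← Finset.sum_sub_distrib, ← Finset.sum_add_distrib,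
    Pi.sub_apply, Pi.smul_apply, smul_eq_mul]
  exact Finset.sum_congr rfl fun i _ => by ring

theorem ip_sub {ι : Type*} [Fintype ι] (s x y : ι → ℝ) : ip s (x - y) = ip s x - ip s y := by
  simp only [ip, Pi.sub_apply, mul_sub, Finset.sum_sub_distrib]

/-- Lemma 1 (characterization of stationary points): with
`z' = (I − AᵀA)x' + Aᵀb`, the point `x'` is stationary for
`r_{μ,λ}(x) + ‖Ax − b‖²` (i.e. `2z' ∈ ∂g_λ(x')`) if and only if
`x' ∈ argmin_x r_{μ,λ}(x) + ‖x − z'‖²`. -/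
theorem stmt6 {m n : ℕ} (A : Matrix (Fin m) (Fin n) ℝ) (b : Fin m → ℝ)
    (μ lam : ℝ) (hμ : 0 < μ) (hlam : 0 ≤ lam) (x' : Fin n → ℝ)
    (z' : Fin n → ℝ) (hz' : z' = x' - Aᵀ *ᵥ (A *ᵥ x') + Aᵀ *ᵥ b) :
    (2 : ℝ) • z' ∈ subdiff (gfun μ lam) x' ↔
      ∀ x : Fin n → ℝ,
        reg μ lam x' + sqnorm (x' - z') ≤ reg μ lam x + sqnorm (x - z') := by
  refine forall_congr' fun y => ?_
  rw [sqnorm_sub, sqnorm_sub, ip_sub, gfun, gfun]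
  constructor <;> intro h <;> linarith
end
end

section
/- Let A ∈ ℝ^{m×n}, b ∈ ℝ^m, μ > 0, λ ≥ 0, and S ⊆ {1, …, n}. Let A_S denote the matrix agreeing with A on the columns indexed by S and zero elsewhere, and let x_S ∈ ℝ^n be supported on S and minimize λ‖x‖₁ + ‖A_S x − b‖² over all vectors x supported on S. Suppose |（x_S)ᵢ| ∉ (0, √μ) for every i, and that the residual ε = A_S x_S − b satisfies ‖A_{S̄}ᵀ ε‖_∞ < √μ, where A_{S̄} = A − A_S. Then x_S is a stationary point of r_{μ,λ}(x) + ‖Ax − b‖², i.e. 2((I − AᵀA)x_S + Aᵀb) ∈ ∂g_λ(x_S). -/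
noncomputable section

open scoped BigOperators

open Matrix

/-- The regularizer without its `ℓ¹` part, plus the square, in one coordinate. -/
def envelope (μ t : ℝ) : ℝ := μ - max (Real.sqrt μ - |t|) 0 ^ 2 + t ^ 2

lemma two_sqrt_mul_abs_le_envelope {μ : ℝ} (hμ : 0 ≤ μ) (t : ℝ) :
    2 * Real.sqrt μ * |t| ≤ envelope μ t := by
  have h := Real.sq_sqrt hμ
  have ht := sq_abs t
  unfold envelope
  rcases le_total (Real.sqrt μ - |t|) 0 with h' | h'
  · rw [max_eq_right h']
    nlinarith [sq_nonneg (Real.sqrt μ - |t|)]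
  · rw [max_eq_left h']
    nlinarith

lemma envelope_zero {μ : ℝ} (hμ : 0 ≤ μ) : envelope μ 0 = 0 := by
  simp [envelope, Real.sq_sqrt hμ]

/-- Off the gap `(0, √μ)`, the slope `2 * x` is a subgradient of the envelope. -/
lemma envelope_subgradient {μ x : ℝ} (hμ : 0 ≤ μ) (hx : |x| ∉ Set.Ioo 0 (Real.sqrt μ)) (y : ℝ) :
    envelope μ x + 2 * x * (y - x) ≤ envelope μ y := by
  have hs := Real.sqrt_nonneg μ
  have h := Real.sq_sqrt hμ
  have hbound := two_sqrt_mul_abs_le_envelope hμ y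
  by_cases hx0 : x = 0
  · subst hx0
    have : 0 ≤ 2 * Real.sqrt μ * |y| := by positivity
    rw [envelope_zero hμ]
    linarith
  have hxs : Real.sqrt μ ≤ |x| := by
    by_contra! hlt
    exact hx ⟨abs_pos.mpr hx0, hlt⟩
  have hex : envelope μ x = μ + x ^ 2 := by
    unfold envelope
    rw [max_eq_right (by linarith)]
    ring
  rw [hex]
  rcases le_total (Real.sqrt μ) |y| with h' | h'
  · unfold envelope
    rw [max_eq_right (by linarith)]
    nlinarith [sq_nonneg (x - y)]
  · have hxy : x * y ≤ |x| * |y| := by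
      rw [← abs_mul]
      exact le_abs_self _
    have := mul_nonneg (sub_nonneg.mpr hxs)
      (show 0 ≤ |x| + Real.sqrt μ - 2 * |y| by linarith)
    nlinarith [sq_abs x]

lemma gfun_eq_sum {n : ℕ} (μ lam : ℝ) (x : Fin n → ℝ) :
    gfun μ lam x = ∑ i, (envelope μ (x i) + lam * |x i|) := by
  simp only [gfun, reg, l1, sqnorm, envelope, Finset.sum_add_distrib, Finset.mul_sum]
  ring

lemma sqnorm_add_smul {ι : Type*} [Fintype ι] (u w : ι → ℝ) (c : ℝ) :
    sqnorm (u + c • w) = sqnorm u + 2 * c * ip w u + c ^ 2 * sqnorm w := by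
  simp only [sqnorm, ip, Finset.mul_sum, ← Finset.sum_add_distrib]
  refine Finset.sum_congr rfl fun i _ => ?_
  simp only [Pi.add_apply, Pi.smul_apply, smul_eq_mul]
  ring

lemma l1_add_single {ι : Type*} [Fintype ι] [DecidableEq ι] (x : ι → ℝ) (j : ι) (c : ℝ) :
    l1 (x + Pi.single j c) = l1 x + (|x j + c| - |x j|) := by
  have h : ∑ i, (|(x + Pi.single j c : ι → ℝ) i| - |x i|) = |x j + c| - |x j| := by
    rw [Finset.sum_eq_single j]
    · simp
    · intro i _ hij
      simp [hij]
    · simp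
  rw [Finset.sum_sub_distrib] at h
  unfold l1
  linarith

lemma nonneg_of_forall_quadratic_nonneg {a C : ℝ}
    (h : ∀ t, 0 < t → t ≤ 1 → 0 ≤ t * a + t ^ 2 * C) : 0 ≤ a := by
  by_contra! ha
  have hC : 0 < |C| - a := by linarith [abs_nonneg C]
  have ht1 : -a / (2 * (|C| - a)) ≤ 1 := by
    rw [div_le_one (by positivity)]
    linarith [abs_nonneg C]
  have ht0 : 0 < -a / (2 * (|C| - a)) := div_pos (by linarith) (by positivity)
  have hmul : -a / (2 * (|C| - a)) * (|C| - a) = -a / 2 := by field_simp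
  have := h _ ht0 ht1
  set t := -a / (2 * (|C| - a))
  have hpos : 0 ≤ a + t * C := by
    by_contra! hn
    nlinarith [mul_neg_of_pos_of_neg ht0 hn]
  nlinarith [mul_le_mul_of_nonneg_left (le_abs_self C) ht0.le, mul_neg_of_pos_of_neg ht0 ha]

/-- Coordinatewise optimality condition for `ℓ¹`-regularized least squares. -/
lemma l1_least_squares_optimality {m n : ℕ} {M : Matrix (Fin m) (Fin n) ℝ} {b : Fin m → ℝ}
    {lam : ℝ} (hlam : 0 ≤ lam) {x : Fin n → ℝ} {j : Fin n}
    (hmin : ∀ c, lam * l1 x + sqnorm (M *ᵥ x - b) ≤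
      lam * l1 (x + Pi.single j c) + sqnorm (M *ᵥ (x + Pi.single j c) - b)) (y : ℝ) :
    lam * |x j| - 2 * (Mᵀ *ᵥ (M *ᵥ x - b)) j * (y - x j) ≤ lam * |y| := by
  have hquad : 0 ≤ lam * (|y| - |x j|) + 2 * (y - x j) * (Mᵀ *ᵥ (M *ᵥ x - b)) j := by
    refine nonneg_of_forall_quadratic_nonneg (C := (y - x j) ^ 2 * sqnorm (M.col j))
      fun t ht ht1 => ?_
    have h := hmin (t * (y - x j))
    have hres : M *ᵥ (x + Pi.single j (t * (y - x j))) - b =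
        (M *ᵥ x - b) + (t * (y - x j)) • M.col j := by
      rw [Matrix.mulVec_add, Matrix.mulVec_single]
      ext i
      simp
      ring
    have hip : ip (M.col j) (M *ᵥ x - b) = (Mᵀ *ᵥ (M *ᵥ x - b)) j := rfl
    rw [hres, sqnorm_add_smul, l1_add_single, hip] at h
    have hconv : |x j + t * (y - x j)| ≤ (1 - t) * |x j| + t * |y| := by
      calc |x j + t * (y - x j)| = |(1 - t) * x j + t * y| := by ring_nf
        _ ≤ |(1 - t) * x j| + |t * y| := abs_add_le _ _
        _ = (1 - t) * |x j| + t * |y| := by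
          rw [abs_mul, abs_mul, abs_of_pos ht, abs_of_nonneg (sub_nonneg.mpr ht1)]
    nlinarith [mul_le_mul_of_nonneg_left hconv hlam]
  linarith

/-- The regularized oracle solution is a stationary point of
`r_{μ,λ}(x) + ‖Ax − b‖²`. -/
theorem stmt7 {m n : ℕ} (A : Matrix (Fin m) (Fin n) ℝ) (b : Fin m → ℝ)
    (μ lam : ℝ) (hμ : 0 < μ) (hlam : 0 ≤ lam)
    (S : Finset (Fin n))
    (AS : Matrix (Fin m) (Fin n) ℝ)
    (hAS : AS = fun i j => if j ∈ S then A i j else 0)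
    (xS : Fin n → ℝ)
    (hsupp : ∀ i, i ∉ S → xS i = 0)
    (hmin : ∀ x : Fin n → ℝ, (∀ i, i ∉ S → x i = 0) →
      lam * l1 xS + sqnorm (AS *ᵥ xS - b) ≤ lam * l1 x + sqnorm (AS *ᵥ x - b))
    (hgap : ∀ i, |xS i| ∉ Set.Ioo 0 (Real.sqrt μ))
    (heps : ∀ j, |((A - AS)ᵀ *ᵥ (AS *ᵥ xS - b)) j| < Real.sqrt μ) :
    (2 : ℝ) • (xS - Aᵀ *ᵥ (A *ᵥ xS) + Aᵀ *ᵥ b) ∈ subdiff (gfun μ lam) xS := by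
  have hμ0 := hμ.le
  have hAx : A *ᵥ xS = AS *ᵥ xS := by
    subst hAS
    ext i
    simp only [Matrix.mulVec, dotProduct]
    refine Finset.sum_congr rfl fun j _ => ?_
    by_cases hj : j ∈ S
    · simp [hj]
    · simp [hsupp j hj]
  have hcoord : ∀ j y, envelope μ (xS j) + lam * |xS j| +
      2 * (xS j - (Aᵀ *ᵥ (AS *ᵥ xS - b)) j) * (y - xS j) ≤ envelope μ y + lam * |y| := by
    intro j y
    have henv := envelope_subgradient hμ0 (hgap j) y
    by_cases hj : j ∈ S
    · have hp : (Aᵀ *ᵥ (AS *ᵥ xS - b)) j = (ASᵀ *ᵥ (AS *ᵥ xS - b)) j := by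
        have hcol : ∀ i, AS i j = A i j := fun i => by simp [hAS, hj]
        simp only [Matrix.mulVec, dotProduct, Matrix.transpose_apply, hcol]
      have hopt := l1_least_squares_optimality (M := AS) (b := b) (x := xS) (j := j) hlam
        (fun c => hmin _ fun i hi => by
          have hij : i ≠ j := fun h => hi (h ▸ hj)
          simp [hsupp i hi, hij]) y
      rw [hp]
      linarith
    · have hp : (Aᵀ *ᵥ (AS *ᵥ xS - b)) j = ((A - AS)ᵀ *ᵥ (AS *ᵥ xS - b)) j := by
        have hcol : ∀ i, AS i j = 0 := fun i => by simp [hAS, hj]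
        simp only [Matrix.mulVec, dotProduct, Matrix.transpose_apply, Matrix.sub_apply, hcol,
          sub_zero]
      have hlt := heps j
      rw [← hp] at hlt
      rw [hsupp j hj, envelope_zero hμ0]
      set p := (Aᵀ *ᵥ (AS *ᵥ xS - b)) j
      have hpy : -(p * y) ≤ Real.sqrt μ * |y| := by
        calc -(p * y) ≤ |p * y| := neg_le_abs _
          _ = |p| * |y| := abs_mul _ _
          _ ≤ Real.sqrt μ * |y| := by gcongr
      have := two_sqrt_mul_abs_le_envelope hμ0 y
      have := mul_nonneg hlam (abs_nonneg y)
      simp only [abs_zero]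
      linarith
  intro y
  rw [gfun_eq_sum, gfun_eq_sum, ip, ← Finset.sum_add_distrib]
  refine Finset.sum_le_sum fun j _ => le_trans (le_of_eq ?_) (hcoord j (y j))
  rw [hAx, Matrix.mulVec_sub]
  simp only [Pi.smul_apply, Pi.add_apply, Pi.sub_apply, smul_eq_mul]
  ring
end
end

section
/- Let A ∈ ℝ^{m×n} satisfy the RIP of order K with constant δ_K ∈ (0, 1), let b ∈ ℝ^m, μ > 0, λ ≥ 0. Suppose x' is a stationary point of r_{μ,λ}(x) + ‖Ax − b‖², i.e. 2z' ∈ ∂g_λ(x') with z' = (I − AᵀA)x' + Aᵀb, and that |z'ᵢ| ∉ [(1−δ_K)√μ + λ/2, √μ/(1−δ_K) + λ/2] for every i. Then for every v ∈ ℝ^n with v ≠ 0 and ‖v‖₀ ≤ K, and every z'' with 2z'' ∈ ∂g_λ(x' + v), one has ⟨2z'' − 2((I − AᵀA)(x'+v) + Aᵀb), v⟩ > 0, that is, ⟨2z'' + ∇h(x' + v), v⟩ > 0 where h(x) = ‖Ax − b‖² − ‖x‖². -/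
noncomputable section

open scoped BigOperators

open Matrix

/-- ℓ⁰ "norm": the number of nonzero entries of `x` -/
def l0 {ι : Type*} [Fintype ι] (x : ι → ℝ) : ℕ :=
  (Finset.univ.filter fun i => x i ≠ 0).card

/-- restricted isometry property of order `K` with constant `δ` -/
def RIP {m n : ℕ} (A : Matrix (Fin m) (Fin n) ℝ) (K : ℕ) (δ : ℝ) : Prop :=
  ∀ x : Fin n → ℝ, l0 x ≤ K →
    (1 - δ) * sqnorm x ≤ sqnorm (A *ᵥ x) ∧ sqnorm (A *ᵥ x) ≤ (1 + δ) * sqnorm x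

/-- One-dimensional profile of `gfun (a ^ 2) lam`. -/
def profile (a lam t : ℝ) : ℝ := a ^ 2 - max (a - |t|) 0 ^ 2 + lam * |t| + t ^ 2

/-- `2 * z` is a subgradient of `profile a lam` at `t`. -/
def HalfSubgradient (a lam t z : ℝ) : Prop :=
  ∀ s, profile a lam t + 2 * z * (s - t) ≤ profile a lam s

lemma profile_neg (a lam t : ℝ) : profile a lam (-t) = profile a lam t := by
  simp [profile]

lemma gfun_eq_sum_profile {n : ℕ} {μ lam : ℝ} (hμ : 0 ≤ μ) (x : Fin n → ℝ) :
    gfun μ lam x = ∑ i, profile (Real.sqrt μ) lam (x i) := by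
  simp only [gfun, reg, l1, sqnorm, profile, Real.sq_sqrt hμ, Finset.mul_sum,
    ← Finset.sum_add_distrib]

lemma halfSubgradient_of_mem_subdiff {n : ℕ} {μ lam : ℝ} (hμ : 0 ≤ μ) {x z : Fin n → ℝ}
    (h : (2 : ℝ) • z ∈ subdiff (gfun μ lam) x) (i : Fin n) :
    HalfSubgradient (Real.sqrt μ) lam (x i) (z i) := by
  intro s
  have hy := h (Function.update x i s)
  rw [gfun_eq_sum_profile hμ, gfun_eq_sum_profile hμ, ip, ← Finset.sum_add_distrib] at hy
  rw [← Finset.add_sum_erase _ _ (Finset.mem_univ i),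
    ← Finset.add_sum_erase _ (fun j => profile _ _ (Function.update x i s j))
      (Finset.mem_univ i)] at hy
  have hrest : ∑ j ∈ Finset.univ.erase i, (profile (Real.sqrt μ) lam (x j) +
        ((2 : ℝ) • z) j * (Function.update x i s - x) j) =
      ∑ j ∈ Finset.univ.erase i, profile (Real.sqrt μ) lam (Function.update x i s j) := by
    refine Finset.sum_congr rfl fun j hj => ?_
    simp [Function.update_of_ne (Finset.ne_of_mem_erase hj)]
  rw [hrest, add_le_add_iff_right] at hy
  simpa using hy

lemma profile_le_quadratic {a lam t s : ℝ} (ht : 0 ≤ t) (hs : 0 ≤ s) :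
    profile a lam s ≤ profile a lam t + (2 * max a t + lam) * (s - t) + (s - t) ^ 2 := by
  simp only [profile, abs_of_nonneg ht, abs_of_nonneg hs]
  rcases le_total a t with h | h <;> rcases le_total a s with h' | h' <;>
    simp only [max_eq_right, max_eq_left, h, h', sub_nonneg, sub_nonpos] <;>
    nlinarith [sq_nonneg (a - s), mul_nonneg (sub_nonneg.2 h) (sub_nonneg.2 h'), sq_nonneg (s - t)]

namespace HalfSubgradient

variable {a lam t z : ℝ}

lemma neg (h : HalfSubgradient a lam t z) : HalfSubgradient a lam (-t) (-z) := by
  intro s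
  have := h (-s)
  rw [profile_neg] at this ⊢
  linarith

lemma eq_of_pos (h : HalfSubgradient a lam t z) (ht : 0 < t) : z = max a t + lam / 2 := by
  have key : ∀ d, -t ≤ d → (2 * z - 2 * max a t - lam) * d ≤ d ^ 2 := by
    intro d hd
    have h1 := h (t + d)
    have h2 := profile_le_quadratic (a := a) (lam := lam) ht.le (s := t + d) (by linarith)
    rw [add_sub_cancel_left] at h1 h2
    linarith
  obtain ⟨c, hc⟩ : ∃ c, c = 2 * z - 2 * max a t - lam := ⟨_, rfl⟩
  rw [← hc] at key
  rcases lt_trichotomy c 0 with h0 | h0 | h0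
  · have h1 := key (max (-t) (c / 2)) (le_max_left _ _)
    have h2 : max (-t) (c / 2) < 0 := max_lt (by linarith) (by linarith)
    nlinarith [le_max_right (-t) (c / 2)]
  · linarith
  · nlinarith [key (c / 2) (by linarith)]

lemma eq_of_neg (h : HalfSubgradient a lam t z) (ht : t < 0) :
    z = -(max a (-t) + lam / 2) := by
  linarith [h.neg.eq_of_pos (neg_pos.2 ht)]

lemma le_of_zero (ha : 0 < a) (h : HalfSubgradient a lam 0 z) : z ≤ a + lam / 2 := by
  have := h a
  simp only [profile, abs_of_pos ha, abs_zero, sub_zero, sub_self, max_eq_left ha.le,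
    max_self] at this
  nlinarith

/-- Off the critical band, the subdifferential grows faster than `δ` times the displacement;
here for a positive displacement. -/
lemma growth_of_pos {δ v w : ℝ} (ha : 0 < a) (hlam : 0 ≤ lam) (hδ : δ ∈ Set.Ioo (0 : ℝ) 1)
    (hz : HalfSubgradient a lam t z) (hw : HalfSubgradient a lam (t + v) w)
    (hout : |z| ∉ Set.Icc ((1 - δ) * a + lam / 2) (a / (1 - δ) + lam / 2)) (hv : 0 < v) :
    δ * v < w - z := by
  obtain ⟨h0, h1⟩ := hδ
  have hδ' : 0 < 1 - δ := by linarith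
  have hdv : δ * v < v := by nlinarith
  have hda : 0 < δ * a := by positivity
  have hout' : |z| < (1 - δ) * a + lam / 2 ∨ a / (1 - δ) + lam / 2 < |z| := by
    by_contra! h
    exact hout h
  have hband : a < a / (1 - δ) := by
    rw [lt_div_iff₀ hδ']
    nlinarith
  have hlarge : ∀ r, a / (1 - δ) < r → a < (1 - δ) * r := fun r hr => by
    rwa [div_lt_iff₀' hδ'] at hr
  have lower : ∀ {s y}, HalfSubgradient a lam s y → 0 ≤ s → -(a + lam / 2) ≤ y := by
    intro s y hs hs0
    rcases hs0.eq_or_lt with rfl | hs0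
    · have := hs.neg
      rw [neg_zero] at this
      linarith [this.le_of_zero ha]
    · linarith [hs.eq_of_pos hs0, le_max_left a s]
  rcases lt_trichotomy t 0 with ht | rfl | ht
  · have hzt := hz.eq_of_neg ht
    have hm1 := le_max_left a (-t)
    have habs : |z| = max a (-t) + lam / 2 := by
      rw [hzt, abs_neg, abs_of_nonneg (by linarith)]
    have hmt : max a (-t) = -t := by
      rcases max_choice a (-t) with h | h
      · rcases hout' with h' | h' <;> linarith
      · exact h
    rcases hout' with h' | h'
    · linarith
    have hl := hlarge (-t) (by linarith)
    rcases lt_trichotomy (t + v) 0 with hs | hs | hs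
    · have hwt := hw.eq_of_neg hs
      rcases max_choice a (-(t + v)) with h | h
      · nlinarith
      · linarith
    · have := lower hw hs.ge
      have : v = -t := by linarith
      subst this
      linarith
    · have hwt := hw.eq_of_pos hs
      linarith [le_max_right a (t + v)]
  · rw [zero_add] at hw
    have hwt := hw.eq_of_pos hv
    have hm := hz.le_of_zero ha
    have hm' := lower hz le_rfl
    rcases hout' with h' | h'
    · have := le_abs_self z
      have := le_max_left a v
      have := le_max_right a v
      nlinarith
    · have : |z| ≤ a + lam / 2 := abs_le.2 ⟨hm', hm⟩
      linarith
  · have hzt := hz.eq_of_pos ht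
    have hwt := hw.eq_of_pos (by linarith)
    have hm1 := le_max_left a t
    have habs : |z| = max a t + lam / 2 := by
      rw [hzt, abs_of_nonneg (by linarith)]
    have hmt : max a t = t := by
      rcases max_choice a t with h | h
      · rcases hout' with h' | h' <;> linarith
      · exact h
    linarith [le_max_right a (t + v)]

lemma growth {δ v w : ℝ} (ha : 0 < a) (hlam : 0 ≤ lam) (hδ : δ ∈ Set.Ioo (0 : ℝ) 1)
    (hz : HalfSubgradient a lam t z) (hw : HalfSubgradient a lam (t + v) w)
    (hout : |z| ∉ Set.Icc ((1 - δ) * a + lam / 2) (a / (1 - δ) + lam / 2)) (hv : v ≠ 0) :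
    δ * v ^ 2 < (w - z) * v := by
  rcases hv.lt_or_gt with hv | hv
  · have hw' := hw.neg
    rw [neg_add] at hw'
    rw [← abs_neg] at hout
    nlinarith [growth_of_pos ha hlam hδ hz.neg hw' hout (neg_pos.2 hv)]
  · nlinarith [growth_of_pos ha hlam hδ hz hw hout hv]

end HalfSubgradient

lemma ip_transpose_mulVec {m n : ℕ} (A : Matrix (Fin m) (Fin n) ℝ) (v : Fin n → ℝ) :
    ip (Aᵀ *ᵥ (A *ᵥ v)) v = sqnorm (A *ᵥ v) := by
  change (Aᵀ *ᵥ (A *ᵥ v)) ⬝ᵥ v = _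
  rw [mulVec_transpose, ← dotProduct_mulVec]
  simp [dotProduct, sqnorm, sq]

/-- Under RIP, the directional growth `⟨2z'' + ∇h(x'+v), v⟩ > 0` holds at every
`K`-sparse perturbation `v ≠ 0` of a stationary point `x'`. -/
theorem stmt10 {m n : ℕ} (A : Matrix (Fin m) (Fin n) ℝ) (b : Fin m → ℝ)
    (K : ℕ) (δ : ℝ) (hδ : δ ∈ Set.Ioo (0:ℝ) 1) (hRIP : RIP A K δ)
    (μ lam : ℝ) (hμ : 0 < μ) (hlam : 0 ≤ lam)
    (x' z' : Fin n → ℝ)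
    (hz' : z' = x' - Aᵀ *ᵥ (A *ᵥ x') + Aᵀ *ᵥ b)
    (hstat : (2:ℝ) • z' ∈ subdiff (gfun μ lam) x')
    (hout : ∀ i, |z' i| ∉
      Set.Icc ((1 - δ) * Real.sqrt μ + lam / 2) (Real.sqrt μ / (1 - δ) + lam / 2)) :
    ∀ v : Fin n → ℝ, v ≠ 0 → l0 v ≤ K → ∀ z'' : Fin n → ℝ,
      (2:ℝ) • z'' ∈ subdiff (gfun μ lam) (x' + v) →
      ip ((2:ℝ) • z'' -
        (2:ℝ) • ((x' + v) - Aᵀ *ᵥ (A *ᵥ (x' + v)) + Aᵀ *ᵥ b)) v > 0 := by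
  intro v hv hvK z'' hz''
  have hsum : δ * sqnorm v < ip (z'' - z') v := by
    rw [sqnorm, ip, Finset.mul_sum]
    have hlt : ∀ i, v i ≠ 0 → δ * v i ^ 2 < (z'' - z') i * v i := fun i hi =>
      (halfSubgradient_of_mem_subdiff hμ.le hstat i).growth (Real.sqrt_pos.2 hμ) hlam hδ
        (halfSubgradient_of_mem_subdiff hμ.le hz'' i) (hout i) hi
    obtain ⟨j, hj⟩ := Function.ne_iff.1 hv
    refine Finset.sum_lt_sum (fun i _ => ?_) ⟨j, Finset.mem_univ j, hlt j hj⟩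
    by_cases hi : v i = 0
    · simp [hi]
    · exact (hlt i hi).le
  have hexpand : ip ((2:ℝ) • z'' - (2:ℝ) • ((x' + v) - Aᵀ *ᵥ (A *ᵥ (x' + v)) + Aᵀ *ᵥ b)) v =
      2 * (ip (z'' - z') v - sqnorm v + ip (Aᵀ *ᵥ (A *ᵥ v)) v) := by
    simp only [hz', ip, sqnorm, ← Finset.sum_sub_distrib, ← Finset.sum_add_distrib,
      Finset.mul_sum, mulVec_add, Pi.add_apply, Pi.sub_apply, Pi.smul_apply, smul_eq_mul]
    exact Finset.sum_congr rfl fun i _ => by ring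
  rw [hexpand, ip_transpose_mulVec]
  linarith [(hRIP v hvK).1]
end
end
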